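/- Let k : 𝔻∖{0} → ℝ be a bounded, nonpositive, continuous function and let u : 𝔻∖{0} → ℝ be a C² solution of Δu(z) = k(z)·e^{2u(z)} on 𝔻∖{0} with ∬_𝔻 e^{2u(z)} dxdy < ∞, and write u(z) = γ·log|z| + r(z) with γ > −1 and r continuous on 𝔻. If γ > −1/2, then the remainder r is of class C¹ on all of 𝔻. -/

import Mathlib

open Metric MeasureTheory
open scoped ENNReal

/-- The Laplacian Δu = ∂²u/∂x² + ∂²u/∂y² of a function on ℂ ≅ ℝ². -/
noncomputable def lapl (u : ℂ → ℝ) (z : ℂ) : ℝ :=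
  fderiv ℝ (fun w => fderiv ℝ u w 1) z 1
    + fderiv ℝ (fun w => fderiv ℝ u w Complex.I) z Complex.I

section

open Filter Topology Complex

/-- Twice the Wirtinger derivative `∂/∂z̄`. -/
noncomputable def dbar (F : ℂ → ℂ) (z : ℂ) : ℂ :=
  fderiv ℝ F z 1 + I * fderiv ℝ F z I

lemma fderiv_unit_add_tangential {F : ℂ → ℂ} {z e : ℂ} (he : e ≠ 0) (hn : ‖e‖ = 1) :
    dbar F z / e = fderiv ℝ F z e + I * fderiv ℝ F z (I * e) := by
  have h1 : fderiv ℝ F z e = e.re * fderiv ℝ F z 1 + e.im * fderiv ℝ F z I := by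
    conv_lhs => rw [show e = e.re • (1 : ℂ) + e.im • I by simp [Complex.re_add_im]]
    rw [map_add, map_smul, map_smul, real_smul, real_smul]
  have h2 : fderiv ℝ F z (I * e) = -e.im * fderiv ℝ F z 1 + e.re * fderiv ℝ F z I := by
    conv_lhs => rw [show I * e = (-e.im) • (1 : ℂ) + e.re • I by
      apply Complex.ext <;> simp]
    rw [map_add, map_smul, map_smul, real_smul, real_smul, ofReal_neg]
  have h3 : (e.re : ℂ) * e.re + e.im * e.im = 1 := by
    have := Complex.normSq_eq_norm_sq e
    rw [hn, Complex.normSq_apply] at this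
    exact_mod_cast (by simpa using this : e.re * e.re + e.im * e.im = 1)
  rw [h1, h2, dbar, div_eq_iff he]
  have he' : e = e.re + e.im * I := (Complex.re_add_im e).symm
  generalize fderiv ℝ F z 1 = a at *
  generalize fderiv ℝ F z I = b at *
  generalize (e.re : ℂ) = x at *
  generalize (e.im : ℂ) = y at *
  rw [he']
  have hI := Complex.I_mul_I
  linear_combination (-(a + I * b)) * h3 + (a * y ^ 2 - b * x * y) * hI

theorem integral_dbar_div_self {F : ℂ → ℂ} (hF : ContDiff ℝ 1 F) (hc : HasCompactSupport F) :
    ∫ ζ, dbar F ζ / ζ = -(2 * Real.pi) * F 0 := by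
  obtain ⟨R, hR, hsupp⟩ := hc.isCompact.isBounded.exists_pos_norm_lt
  have hzero : ∀ z, R ≤ ‖z‖ → fderiv ℝ F z = 0 := by
    intro z hz
    by_contra h
    exact (hsupp z (support_fderiv_subset ℝ h)).not_ge hz
  have hDc : Continuous (fderiv ℝ F) := hF.continuous_fderiv one_ne_zero
  have hdiff : Differentiable ℝ F := hF.differentiable one_ne_zero
  let e : ℝ → ℂ := fun θ => cexp (θ * I)
  have hec : Continuous e := by fun_prop
  have hen : ∀ θ, ‖e θ‖ = 1 := fun θ => Complex.norm_exp_ofReal_mul_I θ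
  have he0 : ∀ θ, e θ ≠ 0 := fun θ => Complex.exp_ne_zero _
  let A : ℝ × ℝ → ℂ := fun p => fderiv ℝ F (p.1 * e p.2) (e p.2)
  let B : ℝ × ℝ → ℂ := fun p => fderiv ℝ F (p.1 * e p.2) (I * e p.2)
  let S : Set (ℝ × ℝ) := Set.Ioi 0 ×ˢ Set.Ioo (-Real.pi) Real.pi
  have hSm : MeasurableSet S := measurableSet_Ioi.prod measurableSet_Ioo
  have hAc : Continuous A := by
    refine (hDc.comp (f := fun p : ℝ × ℝ => (p.1 : ℂ) * e p.2) (by fun_prop)).clm_apply (by fun_prop)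
  have hBc : Continuous B := by
    refine (hDc.comp (f := fun p : ℝ × ℝ => (p.1 : ℂ) * e p.2) (by fun_prop)).clm_apply (by fun_prop)
  have hz' : ∀ p : ℝ × ℝ, p ∈ S \ (Set.Icc 0 R ×ˢ Set.Icc (-Real.pi) Real.pi) →
      fderiv ℝ F (p.1 * e p.2) = 0 := by
    rintro ⟨ρ, θ⟩ ⟨⟨h1, h2⟩, h3⟩
    simp only [Set.mem_Ioi, Set.mem_Ioo] at h1 h2
    apply hzero
    rw [norm_mul, hen, mul_one, Complex.norm_real, Real.norm_of_nonneg h1.le]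
    by_contra! h
    exact h3 ⟨⟨h1.le, h.le⟩, h2.1.le, h2.2.le⟩
  have hK : IsCompact (Set.Icc 0 R ×ˢ Set.Icc (-Real.pi) Real.pi : Set (ℝ × ℝ)) :=
    isCompact_Icc.prod isCompact_Icc
  have hAi : IntegrableOn A S (volume.prod volume) :=
    (hAc.continuousOn.integrableOn_compact hK).of_forall_sdiff_eq_zero hSm
      fun p hp => by simp [A, hz' p hp]
  have hBi : IntegrableOn B S (volume.prod volume) :=
    (hBc.continuousOn.integrableOn_compact hK).of_forall_sdiff_eq_zero hSm
      fun p hp => by simp [B, hz' p hp]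
  have hA : ∫ p in S, A p ∂(volume.prod volume) = -(2 * Real.pi) * F 0 := by
    rw [← setIntegral_prod_swap, setIntegral_prod _ (by exact hAi.swap)]
    have : ∀ θ : ℝ, ∫ ρ in Set.Ioi (0 : ℝ), A (Prod.swap (θ, ρ)) = - F 0 := by
      intro θ
      have hcd : ContDiff ℝ 1 fun ρ : ℝ => F (ρ * e θ) :=
        hF.comp (Complex.ofRealCLM.contDiff.mul contDiff_const)
      have hcs : HasCompactSupport fun ρ : ℝ => F (ρ * e θ) := by
        refine HasCompactSupport.intro (isCompact_Icc (a := -R) (b := R)) fun ρ hρ => ?_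
        by_contra h
        have := hsupp _ (subset_tsupport _ h)
        rw [norm_mul, hen, mul_one, Complex.norm_real, Real.norm_eq_abs, abs_lt] at this
        exact hρ ⟨this.1.le, this.2.le⟩
      have := hcs.integral_Ioi_deriv_eq hcd 0
      simp only [Complex.ofReal_zero, zero_mul] at this
      rw [← this]
      congr 1
      ext ρ
      have hd : HasDerivAt (fun ρ : ℝ => (ρ : ℂ) * e θ) (e θ) ρ := by
        simpa using (Complex.ofRealCLM.hasDerivAt (x := ρ)).mul_const (e θ)
      exact ((hdiff _).hasFDerivAt.comp_hasDerivAt ρ hd).deriv.symm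
    simp only [this]
    rw [setIntegral_const, Measure.real, Real.volume_Ioo,
      ENNReal.toReal_ofReal (by linarith [Real.pi_pos]), Complex.real_smul]
    push_cast
    ring
  have hB : ∫ p in S, B p ∂(volume.prod volume) = 0 := by
    rw [setIntegral_prod _ hBi]
    refine (setIntegral_congr_fun measurableSet_Ioi fun ρ hρ => ?_).trans (integral_zero' _ _)
    simp only [Pi.zero_apply]
    have hρ0 : (ρ : ℂ) ≠ 0 := by exact_mod_cast (ne_of_gt hρ)
    rw [← integral_Ioc_eq_integral_Ioo, ← intervalIntegral.integral_of_le (by linarith [Real.pi_pos])]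
    have hd : ∀ θ : ℝ, HasDerivAt (fun θ : ℝ => (ρ : ℂ)⁻¹ * F (ρ * e θ)) (B (ρ, θ)) θ := by
      intro θ
      have h1 : HasDerivAt (fun θ : ℝ => (ρ : ℂ) * e θ) (ρ * (I * e θ)) θ := by
        have h0 : HasDerivAt (fun θ : ℝ => (θ : ℂ) * I) I θ := by
          simpa using (Complex.ofRealCLM.hasDerivAt (x := θ)).mul_const I
        simpa [e, mul_comm] using h0.cexp.const_mul (ρ : ℂ)
      have h2 := ((hdiff _).hasFDerivAt.comp_hasDerivAt θ h1).const_mul (ρ : ℂ)⁻¹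
      have : (ρ : ℂ) * (I * e θ) = ρ • (I * e θ) := by simp
      rw [this, map_smul, Complex.real_smul, inv_mul_cancel_left₀ hρ0] at h2
      exact h2
    rw [intervalIntegral.integral_eq_sub_of_hasDerivAt (fun θ _ => hd θ)
      ((hBc.comp (by fun_prop : Continuous fun θ : ℝ => (ρ, θ))).intervalIntegrable _ _)]
    simp [e, Complex.exp_neg]
  rw [← Complex.integral_comp_polarCoord_symm]
  calc _ = ∫ p in S, (A p + I * B p) ∂(volume.prod volume) := by
        refine setIntegral_congr_fun hSm ?_
        rintro ⟨ρ, θ⟩ ⟨h1, h2⟩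
        have hρ0 : (ρ : ℂ) ≠ 0 := by exact_mod_cast (ne_of_gt h1)
        simp only [Complex.polarCoord_symm_apply, Complex.real_smul]
        have : (ρ : ℂ) * (Real.cos θ + Real.sin θ * I) = ρ * e θ := by
          simp [e, Complex.exp_mul_I]
        rw [this, mul_comm (ρ : ℂ) (e θ), ← div_div, mul_div_cancel₀ _ hρ0,
          fderiv_unit_add_tangential (he0 θ) (hen θ), mul_comm (e θ)]
    _ = _ := by
        rw [integral_add hAi (hBi.const_mul I), integral_const_mul, hA, hB]
        simp

/-- **Cauchy–Pompeiu formula** for compactly supported `C¹` functions. -/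
theorem integral_dbar_div_sub {F : ℂ → ℂ} (hF : ContDiff ℝ 1 F) (hc : HasCompactSupport F)
    (z : ℂ) : ∫ ζ, dbar F ζ / (ζ - z) = -(2 * Real.pi) * F z := by
  have h := integral_dbar_div_self (F := fun ζ => F (ζ + z)) (by fun_prop)
    (hc.comp_homeomorph (Homeomorph.addRight z))
  simp only [zero_add] at h
  rw [← h, ← integral_add_right_eq_self _ z]
  simp [dbar, fderiv_comp_add_right]

lemma rpow_neg_mul_rpow_neg_le {A B s t : ℝ} (hA : 0 ≤ A) (hB : 0 ≤ B) (hs : 0 < s) (ht : 0 < t) :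
    A ^ (-s) * B ^ (-t) ≤ A ^ (-(s + t)) + B ^ (-(s + t)) := by
  rcases hA.eq_or_lt with rfl | hA
  · rw [Real.zero_rpow (by linarith), zero_mul]
    positivity
  rcases hB.eq_or_lt with rfl | hB
  · rw [Real.zero_rpow (by linarith), mul_zero]
    positivity
  rcases le_total A B with h | h
  · calc A ^ (-s) * B ^ (-t) ≤ A ^ (-s) * A ^ (-t) := by
          gcongr ?_ * ?_
          exact Real.rpow_le_rpow_of_nonpos hA h (by linarith)
      _ = A ^ (-(s + t)) := by rw [← Real.rpow_add hA]; ring_nf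
      _ ≤ _ := le_add_of_nonneg_right (by positivity)
  · calc A ^ (-s) * B ^ (-t) ≤ B ^ (-s) * B ^ (-t) := by
          gcongr ?_ * ?_
          exact Real.rpow_le_rpow_of_nonpos hB h (by linarith)
      _ = B ^ (-(s + t)) := by rw [← Real.rpow_add hB]; ring_nf
      _ ≤ _ := le_add_of_nonneg_left (by positivity)

lemma integrableOn_norm_rpow_neg {s : ℝ} (hs : s < 2) (R : ℝ) :
    IntegrableOn (fun ζ : ℂ => ‖ζ‖ ^ (-s)) (ball 0 R) := by
  refine integrableOn_ball_of_norm_le_rpow (C := 1) (α := s) (by simp) (by simpa using hs) ?_ ?_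
  · filter_upwards with x
    rw [one_mul, Real.norm_of_nonneg (by positivity)]
  · exact (measurable_norm.pow_const _).aestronglyMeasurable

lemma ball_subset_preimage_sub {z : ℂ} (hz : ‖z‖ ≤ 1) :
    ball (0 : ℂ) 1 ⊆ (fun ζ => ζ - z) ⁻¹' ball 0 2 := by
  intro ζ hζ
  rw [mem_ball_zero_iff] at hζ
  rw [Set.mem_preimage, mem_ball_zero_iff]
  linarith [norm_sub_le ζ z]

lemma integrableOn_norm_sub_rpow_neg {s : ℝ} (hs : s < 2) {z : ℂ} (hz : ‖z‖ ≤ 1) :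
    IntegrableOn (fun ζ : ℂ => ‖ζ - z‖ ^ (-s)) (ball 0 1) :=
  (((measurePreserving_sub_right volume z).integrableOn_comp_preimage
    (MeasurableEquiv.subRight z).measurableEmbedding).2
      (integrableOn_norm_rpow_neg hs 2)).mono_set (ball_subset_preimage_sub hz)

lemma setIntegral_norm_sub_rpow_neg_le {s : ℝ} (hs : s < 2) {z : ℂ} (hz : ‖z‖ ≤ 1) :
    ∫ ζ in ball (0 : ℂ) 1, ‖ζ - z‖ ^ (-s) ≤ ∫ ζ in ball (0 : ℂ) 2, ‖ζ‖ ^ (-s) := by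
  rw [← (measurePreserving_sub_right volume z).setIntegral_preimage_emb
    (MeasurableEquiv.subRight z).measurableEmbedding (fun ζ : ℂ => ‖ζ‖ ^ (-s))]
  refine setIntegral_mono_set ?_ ?_ (ball_subset_preimage_sub hz).eventuallyLE
  · exact ((measurePreserving_sub_right volume z).integrableOn_comp_preimage
      (MeasurableEquiv.subRight z).measurableEmbedding).2 (integrableOn_norm_rpow_neg hs 2)
  · filter_upwards with ζ
    simp only [Pi.zero_apply]
    positivity

section CauchyTransform

variable {g : ℂ → ℂ} {S : Set ℂ} {a C : ℝ}

/-- The Cauchy transform of a density with a singularity at `0` converges absolutely. -/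
lemma integrableOn_div_sub (hSm : MeasurableSet S) (hS : S ⊆ ball 0 1)
    (hg : AEStronglyMeasurable g (volume.restrict S)) (ha : 0 < a) (ha1 : a < 1)
    (hb : ∀ ζ ∈ S, ‖g ζ‖ ≤ C * ‖ζ‖ ^ (-a)) {z : ℂ} (hz : ‖z‖ ≤ 1) :
    IntegrableOn (fun ζ => g ζ / (ζ - z)) S := by
  have hs : a + 1 < 2 := by linarith
  have h1 : IntegrableOn (fun ζ : ℂ => |C| * (‖ζ‖ ^ (-(a + 1)) + ‖ζ - z‖ ^ (-(a + 1)))) S := by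
    refine IntegrableOn.mono_set ?_ hS
    exact ((integrableOn_norm_rpow_neg hs 1).add (integrableOn_norm_sub_rpow_neg hs hz)).const_mul _
  have hinv : Measurable fun ζ : ℂ => (ζ - z)⁻¹ := by fun_prop
  simp only [div_eq_mul_inv]
  refine h1.mono' (hg.mul hinv.aestronglyMeasurable) ?_
  filter_upwards [ae_restrict_mem hSm] with ζ hζ
  rw [norm_mul, norm_inv, ← Real.rpow_neg_one]
  calc ‖g ζ‖ * ‖ζ - z‖ ^ (-1 : ℝ) ≤ (|C| * ‖ζ‖ ^ (-a)) * ‖ζ - z‖ ^ (-1 : ℝ) := by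
        gcongr
        exact (hb ζ hζ).trans (by gcongr; exact le_abs_self C)
    _ = |C| * (‖ζ‖ ^ (-a) * ‖ζ - z‖ ^ (-1 : ℝ)) := by ring
    _ ≤ _ := by
        gcongr
        exact rpow_neg_mul_rpow_neg_le (norm_nonneg _) (norm_nonneg _) ha one_pos

/-- The Cauchy kernel is Hölder continuous in its parameter away from the singularities. -/
lemma norm_mul_rpow_neg_mul_le {a δ : ℝ} (ha : 0 < a) (hδ : 0 < δ) (hδ1 : δ < 1) {z ζ : ℂ}
    (h0 : ζ ≠ 0) (hz : ζ ≠ z) :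
    ‖z‖ * (‖ζ‖ ^ (-(1 + a)) * ‖ζ - z‖ ^ (-1 : ℝ)) ≤
      2 * ‖z‖ ^ δ * (‖ζ‖ ^ (-(1 + a + δ)) + ‖ζ - z‖ ^ (-(1 + a + δ))) := by
  have hA : 0 < ‖ζ‖ := norm_pos_iff.2 h0
  have hB : 0 < ‖ζ - z‖ := norm_pos_iff.2 (sub_ne_zero.2 hz)
  have h1 : ‖z‖ ^ (1 - δ) ≤ ‖ζ‖ ^ (1 - δ) + ‖ζ - z‖ ^ (1 - δ) := by
    refine le_trans ?_ (Real.rpow_add_le_add_rpow hA.le hB.le (by linarith) (by linarith))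
    refine Real.rpow_le_rpow (norm_nonneg _) ?_ (by linarith)
    simpa using norm_sub_le ζ (ζ - z)
  have hZ : 0 ≤ ‖z‖ ^ δ := by positivity
  have h2 : ‖z‖ = ‖z‖ ^ δ * ‖z‖ ^ (1 - δ) := by
    rw [← Real.rpow_add' (norm_nonneg _) (by simp)]
    simp
  generalize ‖z‖ = Z at *
  generalize ‖ζ‖ = A at *
  generalize ‖ζ - z‖ = B at *
  calc Z * (A ^ (-(1 + a)) * B ^ (-1 : ℝ))
      = Z ^ δ * Z ^ (1 - δ) * (A ^ (-(1 + a)) * B ^ (-1 : ℝ)) := by rw [← h2]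
    _ ≤ Z ^ δ * (A ^ (1 - δ) + B ^ (1 - δ)) * (A ^ (-(1 + a)) * B ^ (-1 : ℝ)) := by gcongr
    _ = Z ^ δ * (A ^ (-(a + δ)) * B ^ (-1 : ℝ) + A ^ (-(1 + a)) * B ^ (-δ)) := by
        rw [show -(a + δ) = (1 - δ) + -(1 + a) by ring, show -δ = (1 - δ) + -1 by ring,
          Real.rpow_add hA, Real.rpow_add hB]
        ring
    _ ≤ Z ^ δ * ((A ^ (-(a + δ + 1)) + B ^ (-(a + δ + 1))) +
          (A ^ (-(1 + a + δ)) + B ^ (-(1 + a + δ)))) := by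
        gcongr
        · exact rpow_neg_mul_rpow_neg_le hA.le hB.le (by linarith) one_pos
        · exact rpow_neg_mul_rpow_neg_le hA.le hB.le (by linarith) hδ
    _ = _ := by rw [show a + δ + 1 = 1 + a + δ by ring]; ring

/-- The Cauchy transform of a density of size `O(‖ζ‖ ^ (-a))`, `a < 1`, is continuous at `0`. -/
theorem tendsto_setIntegral_div_sub (hSm : MeasurableSet S) (hS : S ⊆ ball 0 1)
    (hg : AEStronglyMeasurable g (volume.restrict S)) (ha : 0 < a) (ha1 : a < 1)
    (hb : ∀ ζ ∈ S, ‖g ζ‖ ≤ C * ‖ζ‖ ^ (-a)) :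
    Tendsto (fun z => ∫ ζ in S, g ζ / (ζ - z)) (𝓝 0) (𝓝 (∫ ζ in S, g ζ / (ζ - 0))) := by
  let δ := (1 - a) / 2
  have hδ : 0 < δ := by simp only [δ]; linarith
  have hδ1 : δ < 1 := by simp only [δ]; linarith
  have hs : 1 + a + δ < 2 := by simp only [δ]; linarith
  let K := ∫ ζ in ball (0 : ℂ) 2, ‖ζ‖ ^ (-(1 + a + δ))
  rw [tendsto_iff_norm_sub_tendsto_zero]
  have hlim : Tendsto (fun z : ℂ => |C| * (2 * ‖z‖ ^ δ * (K + K))) (𝓝 0) (𝓝 0) := by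
    have : ContinuousAt (fun z : ℂ => |C| * (2 * ‖z‖ ^ δ * (K + K))) 0 := by
      have : ContinuousAt (fun z : ℂ => ‖z‖ ^ δ) 0 :=
        continuous_norm.continuousAt.rpow_const (Or.inr hδ.le)
      fun_prop
    simpa [ContinuousAt, Real.zero_rpow hδ.ne'] using this
  refine squeeze_zero' (Eventually.of_forall fun _ => norm_nonneg _) ?_ hlim
  filter_upwards [closedBall_mem_nhds (0 : ℂ) one_pos] with z hz
  rw [mem_closedBall_zero_iff] at hz
  have hi0 : IntegrableOn (fun ζ : ℂ => ‖ζ‖ ^ (-(1 + a + δ))) (ball 0 1) :=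
    integrableOn_norm_rpow_neg hs 1
  have hiz := integrableOn_norm_sub_rpow_neg hs hz
  rw [← integral_sub (integrableOn_div_sub hSm hS hg ha ha1 hb hz)
    (integrableOn_div_sub hSm hS hg ha ha1 hb (by simp))]
  have hiS : IntegrableOn (fun ζ : ℂ => |C| * (2 * ‖z‖ ^ δ *
      (‖ζ‖ ^ (-(1 + a + δ)) + ‖ζ - z‖ ^ (-(1 + a + δ))))) (ball 0 1) :=
    ((hi0.add hiz).const_mul _).const_mul _
  calc _ ≤ ∫ ζ in S, |C| * (2 * ‖z‖ ^ δ *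
      (‖ζ‖ ^ (-(1 + a + δ)) + ‖ζ - z‖ ^ (-(1 + a + δ)))) := by
        refine norm_integral_le_of_norm_le (hiS.mono_set hS) ?_
        filter_upwards [ae_restrict_mem hSm, ae_restrict_of_ae (Measure.ae_ne volume z),
          ae_restrict_of_ae (Measure.ae_ne volume (0 : ℂ))] with ζ hζ hζz hζ0
        have hsub : ζ - z ≠ 0 := sub_ne_zero.2 hζz
        have : g ζ / (ζ - z) - g ζ / (ζ - 0) = g ζ * (z * (ζ⁻¹ * (ζ - z)⁻¹)) := by
          rw [sub_zero]; field_simp; ring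
        rw [this, norm_mul, norm_mul, norm_mul, norm_inv, norm_inv, ← Real.rpow_neg_one,
          ← Real.rpow_neg_one]
        calc _ ≤ (|C| * ‖ζ‖ ^ (-a)) * (‖z‖ * (‖ζ‖ ^ (-1 : ℝ) * ‖ζ - z‖ ^ (-1 : ℝ))) := by
              gcongr
              exact (hb ζ hζ).trans (by gcongr; exact le_abs_self C)
          _ = |C| * (‖z‖ * (‖ζ‖ ^ (-(1 + a)) * ‖ζ - z‖ ^ (-1 : ℝ))) := by
              rw [show -(1 + a) = -a + -1 by ring, Real.rpow_add (norm_pos_iff.2 hζ0)]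
              ring
          _ ≤ _ := by
              refine mul_le_mul_of_nonneg_left ?_ (abs_nonneg C)
              refine (norm_mul_rpow_neg_mul_le ha hδ hδ1 hζ0 hζz).trans_eq ?_
              rfl
    _ ≤ ∫ ζ in ball 0 1, |C| * (2 * ‖z‖ ^ δ *
      (‖ζ‖ ^ (-(1 + a + δ)) + ‖ζ - z‖ ^ (-(1 + a + δ)))) := by
        refine setIntegral_mono_set hiS ?_ hS.eventuallyLE
        filter_upwards with ζ
        simp only [Pi.zero_apply]
        positivity
    _ ≤ _ := by
        rw [integral_const_mul, integral_const_mul, integral_add hi0 hiz]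
        gcongr
        · simpa only [sub_zero] using setIntegral_norm_sub_rpow_neg_le (z := 0) hs (by simp)
        · exact setIntegral_norm_sub_rpow_neg_le hs hz

end CauchyTransform

lemma ContDiffOn.contDiff_mul_of_tsupport_subset {φ w : ℂ → ℂ} {U : Set ℂ} (hU : IsOpen U)
    (hφ : ContDiff ℝ 1 φ) (hw : ContDiffOn ℝ 1 w U) (hsub : tsupport φ ⊆ U) :
    ContDiff ℝ 1 (fun ζ => φ ζ * w ζ) := by
  rw [contDiff_iff_contDiffAt]
  intro x
  by_cases hx : x ∈ tsupport φ
  · exact hφ.contDiffAt.mul (hw.contDiffAt (hU.mem_nhds (hsub hx)))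
  · have h0 : (fun ζ => φ ζ * w ζ) =ᶠ[𝓝 x] fun _ => 0 := by
      filter_upwards [notMem_tsupport_iff_eventuallyEq.1 hx] with y hy
      simp [hy]
    exact contDiffAt_const.congr_of_eventuallyEq h0

lemma dbar_mul {φ w : ℂ → ℂ} {z : ℂ} (hφ : DifferentiableAt ℝ φ z) (hw : DifferentiableAt ℝ w z) :
    dbar (fun ζ => φ ζ * w ζ) z = φ z * dbar w z + dbar φ z * w z := by
  have := fderiv_mul hφ hw
  change fderiv ℝ (fun ζ => φ ζ * w ζ) z = _ at this
  simp only [dbar, this]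
  simp
  ring

lemma dbar_sub {φ w : ℂ → ℂ} {z : ℂ} (hφ : DifferentiableAt ℝ φ z) (hw : DifferentiableAt ℝ w z) :
    dbar (fun ζ => φ ζ - w ζ) z = dbar φ z - dbar w z := by
  simp only [dbar, fderiv_fun_sub hφ hw]
  simp
  ring

lemma dbar_comp_smul (φ : ℂ → ℂ) (c : ℝ) (z : ℂ) :
    dbar (fun ζ => φ (c • ζ)) z = c * dbar φ (c • z) := by
  simp only [dbar, fderiv_comp_smul]
  simp
  ring

lemma support_dbar_subset (φ : ℂ → ℂ) : Function.support (dbar φ) ⊆ tsupport φ := by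
  intro z hz
  by_contra h
  have : fderiv ℝ φ z = 0 := by
    by_contra h'
    exact h (support_fderiv_subset ℝ h')
  exact hz (by simp [dbar, this])

lemma ContDiff.dbar {φ : ℂ → ℂ} {m n : WithTop ℕ∞} (hφ : ContDiff ℝ n φ) (hmn : m + 1 ≤ n) :
    ContDiff ℝ m (dbar φ) := by
  have := hφ.fderiv_right hmn
  unfold _root_.dbar
  fun_prop

lemma ContDiffOn.continuousOn_dbar {w : ℂ → ℂ} {U : Set ℂ} (hU : IsOpen U)
    (hw : ContDiffOn ℝ 1 w U) : ContinuousOn (dbar w) U := by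
  have := hw.continuousOn_fderiv_of_isOpen hU le_rfl
  unfold dbar
  fun_prop

/-- Integrating by parts against the gradient `w = ∂ρ/∂x - i ∂ρ/∂y` of a bounded function. -/
lemma norm_integral_mul_gradient_le {U : Set ℂ} (hU : IsOpen U) {w h : ℂ → ℂ} {ρ : ℂ → ℂ}
    (hρ : ContDiffOn ℝ 1 ρ U) (hw : ∀ ζ ∈ U, w ζ = fderiv ℝ ρ ζ 1 - I * fderiv ℝ ρ ζ I)
    (hh : ContDiff ℝ 1 h) {t L ω : ℝ} (ht : 0 ≤ t) (hsub : tsupport h ⊆ U)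
    (hsub' : tsupport h ⊆ ball 0 t)
    (hL : ∀ ζ, ‖fderiv ℝ h ζ‖ ≤ L) (hω : ∀ ζ ∈ U ∩ ball 0 t, ‖ρ ζ‖ ≤ ω) (hω0 : 0 ≤ ω) :
    ‖∫ ζ, h ζ * w ζ‖ ≤ 2 * L * ω * (t ^ 2 * Real.pi) := by
  have hL0 : 0 ≤ L := (norm_nonneg _).trans (hL 0)
  have hcs : HasCompactSupport h :=
    (isCompact_closedBall (0 : ℂ) t).of_isClosed_subset (isClosed_tsupport h)
      (hsub'.trans ball_subset_closedBall)
  have hDρ := hρ.continuousOn_fderiv_of_isOpen hU le_rfl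
  have hDh := hh.continuous_fderiv one_ne_zero
  have hDh0 : ∀ ζ ∉ tsupport h, fderiv ℝ h ζ = 0 := by
    intro ζ hζ
    by_contra h'
    exact hζ (support_fderiv_subset ℝ h')
  have key : ∀ f : ℂ → ℂ, ContinuousOn f U → (∀ ζ ∉ tsupport h, f ζ = 0) → Integrable f := by
    intro f hf h0
    have hs : tsupport f ⊆ tsupport h :=
      closure_minimal (fun ζ hζ => by by_contra h'; exact hζ (h0 ζ h')) (isClosed_tsupport h)
    exact (hf.continuous_of_tsupport_subset hU (hs.trans hsub)).integrable_of_hasCompactSupport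
      (hcs.of_isClosed_subset (isClosed_tsupport f) hs)
  have i1 : ∀ v, Integrable fun ζ => fderiv ℝ h ζ v * ρ ζ := fun v =>
    key _ ((hDh.clm_apply continuous_const).continuousOn.mul hρ.continuousOn)
      fun ζ hζ => by simp [hDh0 ζ hζ]
  have i2 : ∀ v, Integrable fun ζ => h ζ * fderiv ℝ ρ ζ v := fun v =>
    key _ (hh.continuous.continuousOn.mul (hDρ.clm_apply continuousOn_const))
      fun ζ hζ => by simp [image_eq_zero_of_notMem_tsupport hζ]
  have i3 : Integrable fun ζ => h ζ * ρ ζ :=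
    key _ (hh.continuous.continuousOn.mul hρ.continuousOn)
      fun ζ hζ => by simp [image_eq_zero_of_notMem_tsupport hζ]
  have ibp : ∀ v, ∫ ζ, h ζ * fderiv ℝ ρ ζ v = -∫ ζ, fderiv ℝ h ζ v * ρ ζ := fun v =>
    integral_mul_fderiv_eq_neg_fderiv_mul_of_integrable (i1 v) (i2 v) i3
      (fun x _ => (hh.differentiable one_ne_zero).differentiableAt)
      (fun x hx => (hρ.differentiableOn one_ne_zero).differentiableAt (hU.mem_nhds (hsub hx)))
  have hB : ∀ v : ℂ, ‖v‖ = 1 → ‖∫ ζ, fderiv ℝ h ζ v * ρ ζ‖ ≤ L * ω * (t ^ 2 * Real.pi) := by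
    intro v hv
    rw [← setIntegral_eq_integral_of_forall_compl_eq_zero (s := ball 0 t)
      (fun ζ hζ => by simp [hDh0 ζ (fun h' => hζ (hsub' h'))])]
    have hvol : volume.real (ball (0 : ℂ) t) = t ^ 2 * Real.pi := by
      rw [Measure.real, Complex.volume_ball]
      simp [ENNReal.toReal_ofReal ht]
    rw [← hvol]
    refine norm_setIntegral_le_of_norm_le_const measure_ball_lt_top fun ζ hζ => ?_
    by_cases hs : ζ ∈ tsupport h
    · rw [norm_mul]
      gcongr
      · exact ((fderiv ℝ h ζ).le_opNorm v).trans (by simpa [hv] using hL ζ)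
      · exact hω ζ ⟨hsub hs, hζ⟩
    · rw [hDh0 ζ hs]
      simp only [zero_apply, zero_mul, norm_zero]
      positivity
  have heq : ∫ ζ, h ζ * w ζ =
      -(∫ ζ, fderiv ℝ h ζ 1 * ρ ζ) + I * ∫ ζ, fderiv ℝ h ζ I * ρ ζ := by
    calc _ = ∫ ζ, (h ζ * fderiv ℝ ρ ζ 1 - I * (h ζ * fderiv ℝ ρ ζ I)) := by
          congr 1
          ext ζ
          by_cases hs : ζ ∈ tsupport h
          · rw [hw ζ (hsub hs)]
            ring
          · simp [image_eq_zero_of_notMem_tsupport hs]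
      _ = _ := by
          rw [integral_sub (i2 1) ((i2 I).const_mul I), integral_const_mul, ibp, ibp]
          ring
  rw [heq]
  refine (norm_add_le _ _).trans ?_
  rw [norm_neg, norm_mul, norm_I, one_mul]
  linarith [hB 1 (by simp), hB I (by simp)]

lemma norm_fderiv_inv_sub {z ζ : ℂ} (h : ζ ≠ z) :
    ‖fderiv ℝ (fun ξ : ℂ => (ξ - z)⁻¹) ζ‖ = (‖ζ - z‖⁻¹) ^ 2 := by
  have h0 : ζ - z ≠ 0 := sub_ne_zero.2 h
  have h1 : HasDerivAt (fun ξ : ℂ => (ξ - z)⁻¹) (-1 / (ζ - z) ^ 2) ζ :=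
    ((hasDerivAt_id ζ).sub_const z).inv h0
  have h2 := h1.hasFDerivAt.restrictScalars ℝ
  rw [h2.fderiv, ContinuousLinearMap.norm_restrictScalars]
  simp

lemma isOpen_punctured_ball : IsOpen (ball (0 : ℂ) 1 \ {0}) :=
  isOpen_ball.sdiff isClosed_singleton

/-- The error made by removing a disk of radius `ε` around the singularity tends to zero. -/
lemma tendsto_integral_annular_cutoff {w ρ Y : ℂ → ℂ} {z : ℂ} (hz : z ≠ 0)
    (hρ : ContDiffOn ℝ 1 ρ (ball 0 1 \ {0})) (hρ0 : Tendsto ρ (𝓝 0) (𝓝 0))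
    (hw : ∀ ζ ∈ ball (0 : ℂ) 1 \ {0}, w ζ = fderiv ℝ ρ ζ 1 - I * fderiv ℝ ρ ζ I)
    (hY : ContDiff ℝ 1 Y) (hYs : Function.support Y ⊆ closedBall 0 (1 / 2) \ ball 0 (1 / 4)) :
    Tendsto (fun ε : ℝ => ∫ ζ, (ε⁻¹ * Y (ε⁻¹ • ζ)) * (ζ - z)⁻¹ * w ζ) (𝓝[>] 0) (𝓝 0) := by
  have hYc : HasCompactSupport Y :=
    HasCompactSupport.intro (isCompact_closedBall (0 : ℂ) (1 / 2)) fun x hx => by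
      by_contra h
      exact hx (hYs h).1
  obtain ⟨M₀, hM₀⟩ := hYc.exists_bound_of_continuous hY.continuous
  obtain ⟨M₁, hM₁⟩ := (hYc.fderiv ℝ).exists_bound_of_continuous (hY.continuous_fderiv one_ne_zero)
  have hM₀0 : 0 ≤ M₀ := (norm_nonneg _).trans (hM₀ 0)
  have hM₁0 : 0 ≤ M₁ := (norm_nonneg _).trans (hM₁ 0)
  have hzn : 0 < ‖z‖ := norm_pos_iff.2 hz
  let d := ‖z‖ / 2
  have hd : 0 < d := by positivity
  let A := M₀ * (d⁻¹) ^ 2 + d⁻¹ * M₁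
  have hA : 0 ≤ A := by positivity
  have main : ∀ ω > 0, ∀ᶠ ε : ℝ in 𝓝[>] 0,
      ‖∫ ζ, (ε⁻¹ * Y (ε⁻¹ • ζ)) * (ζ - z)⁻¹ * w ζ‖ ≤ 2 * A * Real.pi * ω := by
    intro ω hω
    obtain ⟨τ, hτ, hτω⟩ := Metric.tendsto_nhds_nhds.1 hρ0 ω hω
    have hev : Set.Ioo 0 (min (min τ ‖z‖) 1) ∈ 𝓝[>] (0 : ℝ) :=
      Ioo_mem_nhdsGT (by positivity)
    filter_upwards [hev] with ε hε
    obtain ⟨hε0, hε⟩ := hε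
    have hετ : ε < τ := hε.trans_le ((min_le_left _ _).trans (min_le_left _ _))
    have hεz : ε < ‖z‖ := hε.trans_le ((min_le_left _ _).trans (min_le_right _ _))
    have hε1 : ε < 1 := hε.trans_le (min_le_right _ _)
    let φ : ℂ → ℂ := fun ζ => (ε⁻¹ : ℝ) * Y (ε⁻¹ • ζ)
    let h : ℂ → ℂ := fun ζ => φ ζ * (ζ - z)⁻¹
    have hφs : tsupport φ ⊆ closedBall 0 (ε / 2) \ ball 0 (ε / 4) := by
      refine closure_minimal ?_ (isClosed_closedBall.sdiff isOpen_ball)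
      intro ζ hζ
      have hYζ : ε⁻¹ • ζ ∈ Function.support Y := fun h' =>
        hζ (show φ ζ = 0 by simp only [φ, h', mul_zero])
      have := hYs hYζ
      simp only [Set.mem_sdiff, mem_closedBall_zero_iff, mem_ball_zero_iff, norm_smul, norm_inv,
        Real.norm_of_nonneg hε0.le, not_lt] at this ⊢
      rw [inv_mul_le_iff₀ hε0, le_inv_mul_iff₀ hε0] at this
      constructor <;> linarith
    have hne : ∀ ζ ∈ closedBall (0 : ℂ) (ε / 2), d ≤ ‖ζ - z‖ := by
      intro ζ hζ
      rw [mem_closedBall_zero_iff] at hζ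
      have := norm_sub_norm_le z ζ
      rw [norm_sub_rev] at this
      simp only [d]
      linarith
    have hne' : ∀ ζ ∈ closedBall (0 : ℂ) (ε / 2), ζ ≠ z := by
      intro ζ hζ h'
      have := hne ζ hζ
      rw [h', sub_self, norm_zero] at this
      linarith
    have hφ1 : ContDiff ℝ 1 φ := by fun_prop
    have hk : ContDiffOn ℝ 1 (fun ζ : ℂ => (ζ - z)⁻¹) {z}ᶜ :=
      (contDiffOn_id.sub contDiffOn_const).inv fun x hx => sub_ne_zero.2 hx
    have hh : ContDiff ℝ 1 h := hk.contDiff_mul_of_tsupport_subset isOpen_compl_singleton hφ1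
      fun ζ hζ => hne' ζ (hφs hζ).1
    have hhs : tsupport h ⊆ closedBall 0 (ε / 2) \ ball 0 (ε / 4) :=
      tsupport_mul_subset_left.trans hφs
    have hL : ∀ ζ, ‖fderiv ℝ h ζ‖ ≤ (ε⁻¹) ^ 2 * A := by
      intro ζ
      by_cases hζ : ζ ∈ tsupport h
      · have hζ' := (hhs hζ).1
        have hdk : DifferentiableAt ℝ (fun ζ : ℂ => (ζ - z)⁻¹) ζ :=
          (hk.differentiableOn one_ne_zero).differentiableAt
            (isOpen_compl_singleton.mem_nhds (hne' ζ hζ'))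
        have e1 : fderiv ℝ h ζ = φ ζ • fderiv ℝ (fun ζ : ℂ => (ζ - z)⁻¹) ζ +
            (ζ - z)⁻¹ • fderiv ℝ φ ζ :=
          fderiv_mul (hφ1.differentiable one_ne_zero).differentiableAt hdk
        have e2 : fderiv ℝ φ ζ = ((ε⁻¹ : ℝ) : ℂ) • (ε⁻¹ : ℝ) • fderiv ℝ Y (ε⁻¹ • ζ) := by
          have hYd : DifferentiableAt ℝ (fun ζ => Y (ε⁻¹ • ζ)) ζ :=
            ((hY.differentiable one_ne_zero).comp (by fun_prop)).differentiableAt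
          simp only [φ]
          rw [fderiv_const_mul hYd, fderiv_comp_smul]
        have b1 : ‖φ ζ‖ ≤ ε⁻¹ * M₀ := by
          simp only [φ]
          rw [norm_mul, Complex.norm_real, Real.norm_of_nonneg (by positivity)]
          gcongr
          exact hM₀ _
        have b2 : ‖fderiv ℝ φ ζ‖ ≤ ε⁻¹ * (ε⁻¹ * M₁) := by
          rw [e2, norm_smul, norm_smul, Complex.norm_real, Real.norm_of_nonneg (by positivity)]
          gcongr
          exact hM₁ _
        have b3 : ‖ζ - z‖⁻¹ ≤ d⁻¹ := inv_anti₀ hd (hne ζ hζ')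
        have hc : 1 ≤ ε⁻¹ := (one_le_inv₀ hε0).2 hε1.le
        rw [e1]
        calc _ ≤ ‖φ ζ‖ * (‖ζ - z‖⁻¹) ^ 2 + ‖ζ - z‖⁻¹ * ‖fderiv ℝ φ ζ‖ := by
              refine (norm_add_le _ _).trans ?_
              rw [norm_smul, norm_smul, norm_fderiv_inv_sub (hne' ζ hζ'), norm_inv]
          _ ≤ (ε⁻¹ * M₀) * (d⁻¹) ^ 2 + d⁻¹ * (ε⁻¹ * (ε⁻¹ * M₁)) := by gcongr
          _ ≤ ((ε⁻¹) ^ 2 * M₀) * (d⁻¹) ^ 2 + d⁻¹ * (ε⁻¹ * (ε⁻¹ * M₁)) := by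
              gcongr
              nlinarith
          _ = _ := by simp only [A]; ring
      · have : fderiv ℝ h ζ = 0 := by
          by_contra h'
          exact hζ (support_fderiv_subset ℝ h')
        rw [this, norm_zero]
        positivity
    have := norm_integral_mul_gradient_le isOpen_punctured_ball hρ hw hh (t := ε) (ω := ω) hε0.le
      (fun ζ hζ => ?_) (fun ζ hζ => ?_) hL
      (fun ζ hζ => ?_) hω.le
    · refine le_trans this (le_of_eq ?_)
      field_simp
    · have := hhs hζ
      simp only [Set.mem_sdiff, mem_closedBall_zero_iff, mem_ball_zero_iff, not_lt,
        Set.mem_singleton_iff] at this ⊢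
      exact ⟨by linarith, fun h0 => by rw [h0, norm_zero] at this; linarith⟩
    · have := (hhs hζ).1
      rw [mem_closedBall_zero_iff] at this
      rw [mem_ball_zero_iff]
      linarith
    · have h1 := hζ.2
      rw [mem_ball] at h1
      simpa using (hτω (h1.trans hετ)).le
  rw [Metric.tendsto_nhds]
  intro η hη
  filter_upwards [main (η / (2 * A * Real.pi + 1)) (by positivity)] with ε hε
  rw [dist_zero_right]
  refine hε.trans_lt ?_
  rw [mul_div_assoc', div_lt_iff₀ (by positivity)]
  nlinarith

/-- The term produced by differentiating a cutoff function which is constant near `0` is bounded. -/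
lemma exists_bound_dbar_mul {w φ : ℂ → ℂ} (hw : ContDiffOn ℝ 1 w (ball 0 1 \ {0}))
    (hφ : ContDiff ℝ 1 φ) {t a : ℝ} (ht : 0 < t) (ha : 0 < a)
    (hs : Function.support (dbar φ) ⊆ closedBall 0 (1 / 2) \ ball 0 t) :
    ∃ M, ∀ ζ ∈ ball (0 : ℂ) 1 \ {0}, ‖dbar φ ζ * w ζ‖ ≤ M * ‖ζ‖ ^ (-a) := by
  have hK : IsCompact (closedBall (0 : ℂ) (1 / 2) \ ball 0 t) :=
    (isCompact_closedBall _ _).diff isOpen_ball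
  have hKS : closedBall (0 : ℂ) (1 / 2) \ ball 0 t ⊆ ball 0 1 \ {0} := by
    intro ζ hζ
    simp only [Set.mem_sdiff, mem_closedBall_zero_iff, mem_ball_zero_iff, not_lt,
      Set.mem_singleton_iff] at hζ ⊢
    exact ⟨by linarith, fun h0 => by rw [h0, norm_zero] at hζ; linarith⟩
  obtain ⟨M, hM⟩ := hK.exists_bound_of_continuousOn
    ((hφ.dbar (m := 0) (by simp)).continuous.continuousOn.mul (hw.continuousOn.mono hKS))
  refine ⟨|M|, fun ζ hζ => ?_⟩
  have h1 : ‖ζ‖ < 1 := by simpa using hζ.1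
  have h0 : 0 < ‖ζ‖ := norm_pos_iff.2 hζ.2
  by_cases hz : ζ ∈ closedBall (0 : ℂ) (1 / 2) \ ball 0 t
  · refine ((hM ζ hz).trans (le_abs_self M)).trans ?_
    exact le_mul_of_one_le_right (abs_nonneg M)
      (Real.one_le_rpow_of_pos_of_le_one_of_nonpos h0 h1.le (by linarith))
  · have : dbar φ ζ = 0 := by
      by_contra h
      exact hz (hs h)
    rw [this, zero_mul, norm_zero]
    positivity

/-- There is a smooth cutoff function equal to `1` on `‖ζ‖ ≤ 1/4` and to `0` on `1/2 ≤ ‖ζ‖`. -/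
lemma exists_cutoff : ∃ X : ℂ → ℂ, ContDiff ℝ 2 X ∧ (∀ ζ, ‖ζ‖ ≤ 1 / 4 → X ζ = 1) ∧
    (∀ ζ, 1 / 2 ≤ ‖ζ‖ → X ζ = 0) ∧ ∀ ζ, ‖X ζ‖ ≤ 1 := by
  let χ : ContDiffBump (0 : ℂ) := ⟨1 / 4, 1 / 2, by norm_num, by norm_num⟩
  refine ⟨fun ζ => (χ ζ : ℂ), Complex.ofRealCLM.contDiff.comp χ.contDiff, fun ζ h => ?_,
    fun ζ h => ?_, fun ζ => ?_⟩
  · beta_reduce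
    rw [χ.one_of_mem_closedBall (by simpa [χ] using h), ofReal_one]
  · beta_reduce
    rw [χ.zero_of_le_dist (by simpa [χ] using h), ofReal_zero]
  · rw [Complex.norm_real, Real.norm_of_nonneg χ.nonneg]
    exact χ.le_one

lemma support_dbar_subset_annulus {X : ℂ → ℂ} {s t : ℝ} (h1 : ∀ ζ, ‖ζ‖ ≤ s → X ζ = 1)
    (h0 : ∀ ζ, t ≤ ‖ζ‖ → X ζ = 0) :
    Function.support (dbar X) ⊆ closedBall 0 t \ ball 0 s := by
  intro ζ hζ
  constructor
  · refine closure_minimal (fun ξ hξ => ?_) isClosed_closedBall (support_dbar_subset X hζ)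
    rw [mem_closedBall_zero_iff]
    by_contra! h
    exact hξ (h0 ξ h.le)
  · intro h
    have : X =ᶠ[𝓝 ζ] fun _ => 1 := by
      filter_upwards [isOpen_ball.mem_nhds h] with ξ hξ
      exact h1 ξ (mem_ball_zero_iff.1 hξ).le
    exact hζ (by simp [dbar, this.fderiv_eq])

/-- Cauchy–Pompeiu representation of the gradient `w` of a function `ρ` which is continuous at the
puncture and whose Laplacian `dbar w` has an integrable singularity there. -/
lemma eq_setIntegral_of_dbar_bound {w ρ X : ℂ → ℂ} {a C : ℝ}
    (hw : ContDiffOn ℝ 1 w (ball 0 1 \ {0}))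
    (hρ : ContDiffOn ℝ 1 ρ (ball 0 1 \ {0})) (hρ0 : Tendsto ρ (𝓝 0) (𝓝 0))
    (hgrad : ∀ ζ ∈ ball (0 : ℂ) 1 \ {0}, w ζ = fderiv ℝ ρ ζ 1 - I * fderiv ℝ ρ ζ I)
    (hX : ContDiff ℝ 2 X) (hX1 : ∀ ζ, ‖ζ‖ ≤ 1 / 4 → X ζ = 1) (hX0 : ∀ ζ, 1 / 2 ≤ ‖ζ‖ → X ζ = 0)
    (hXn : ∀ ζ, ‖X ζ‖ ≤ 1) (ha : 0 < a) (ha1 : a < 1)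
    (hb1 : ∀ ζ ∈ ball (0 : ℂ) 1 \ {0}, ‖X ζ * dbar w ζ‖ ≤ C * ‖ζ‖ ^ (-a))
    (hb2 : ∀ ζ ∈ ball (0 : ℂ) 1 \ {0}, ‖dbar X ζ * w ζ‖ ≤ C * ‖ζ‖ ^ (-a))
    {z : ℂ} (hz : z ≠ 0) (hz4 : ‖z‖ < 1 / 4) :
    -(2 * Real.pi) * w z =
      ∫ ζ in ball (0 : ℂ) 1 \ {0}, (X ζ * dbar w ζ + dbar X ζ * w ζ) / (ζ - z) := by
  set S : Set ℂ := ball 0 1 \ {0} with hS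
  have hSo : IsOpen S := isOpen_punctured_ball
  have hSm : MeasurableSet S := hSo.measurableSet
  have hSb : S ⊆ ball 0 1 := Set.sdiff_subset
  have hz1 : ‖z‖ ≤ 1 := by linarith
  have hzn : 0 < ‖z‖ := norm_pos_iff.2 hz
  have hX' : ContDiff ℝ 1 X := hX.of_le one_le_two
  have hdX : ContDiff ℝ 1 (dbar X) := hX.dbar (by norm_num)
  have hdw : ContinuousOn (dbar w) S := hw.continuousOn_dbar hSo
  let Xc : ℝ → ℂ → ℂ := fun ε ζ => X (ε⁻¹ • ζ)
  have hXc' : ∀ ε, ContDiff ℝ 1 (Xc ε) := fun ε => by simp only [Xc]; fun_prop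
  have hmeas : ∀ φ v : ℂ → ℂ, Continuous φ → ContinuousOn v S →
      AEStronglyMeasurable (fun ζ => φ ζ * v ζ) (volume.restrict S) := fun φ v hφ hv =>
    (hφ.continuousOn.mul hv).aestronglyMeasurable hSm
  have hi1 : IntegrableOn (fun ζ => X ζ * dbar w ζ / (ζ - z)) S :=
    integrableOn_div_sub hSm hSb (hmeas _ _ hX.continuous hdw) ha ha1 hb1 hz1
  have hi2 : IntegrableOn (fun ζ => dbar X ζ * w ζ / (ζ - z)) S :=
    integrableOn_div_sub hSm hSb (hmeas _ _ hdX.continuous hw.continuousOn) ha ha1 hb2 hz1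
  have hscale : ∀ ε : ℝ, 0 < ε → ∀ ζ : ℂ, ‖ε⁻¹ • ζ‖ = ‖ζ‖ / ε := fun ε hε ζ => by
    rw [norm_smul, norm_inv, Real.norm_of_nonneg hε.le, inv_mul_eq_div]
  have hXc1 : ∀ ε : ℝ, 0 < ε → ∀ ζ : ℂ, ‖ζ‖ ≤ ε / 4 → Xc ε ζ = 1 := fun ε hε ζ h =>
    hX1 _ (by rw [hscale ε hε, div_le_iff₀ hε]; linarith)
  have hXc0 : ∀ ε : ℝ, 0 < ε → ∀ ζ : ℂ, ε / 2 ≤ ‖ζ‖ → Xc ε ζ = 0 := fun ε hε ζ h =>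
    hX0 _ (by rw [hscale ε hε, le_div_iff₀ hε]; linarith)
  have hev : Set.Ioo 0 (min ‖z‖ (1 / 2)) ∈ 𝓝[>] (0 : ℝ) := Ioo_mem_nhdsGT (by positivity)
  have hXcX : ∀ ε : ℝ, 0 < ε → ε < 1 / 2 → ∀ ζ, ‖Xc ε ζ‖ ≤ ‖X ζ‖ := by
    intro ε hε hε2 ζ
    by_cases h : ε / 2 ≤ ‖ζ‖
    · rw [hXc0 ε hε ζ h, norm_zero]
      positivity
    · rw [hX1 ζ (by linarith), norm_one]
      exact hXn _
  have hle : ∀ ε : ℝ, 0 < ε → ε < 1 / 2 → ∀ ζ,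
      ‖Xc ε ζ * dbar w ζ / (ζ - z)‖ ≤ ‖X ζ * dbar w ζ / (ζ - z)‖ := by
    intro ε hε hε2 ζ
    rw [norm_div, norm_div, norm_mul, norm_mul]
    gcongr
    exact hXcX ε hε hε2 ζ
  have hinv : Measurable fun ζ : ℂ => (ζ - z)⁻¹ := by fun_prop
  have hmeas' : ∀ ε, AEStronglyMeasurable (fun ζ => Xc ε ζ * dbar w ζ / (ζ - z))
      (volume.restrict S) := fun ε => by
    simp only [div_eq_mul_inv]
    exact (hmeas _ _ (hXc' ε).continuous hdw).mul hinv.aestronglyMeasurable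
  have hT1 : Tendsto (fun ε => ∫ ζ in S, Xc ε ζ * dbar w ζ / (ζ - z)) (𝓝[>] 0) (𝓝 0) := by
    have := tendsto_integral_filter_of_dominated_convergence (μ := volume.restrict S)
      (F := fun ε ζ => Xc ε ζ * dbar w ζ / (ζ - z)) (f := fun _ => 0) (l := 𝓝[>] (0 : ℝ))
      (fun ζ => ‖X ζ * dbar w ζ / (ζ - z)‖) (Eventually.of_forall hmeas') ?_ hi1.norm ?_
    · simpa using this
    · filter_upwards [hev] with ε hε
      exact Eventually.of_forall (hle ε hε.1 (hε.2.trans_le (min_le_right _ _)))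
    · filter_upwards [ae_restrict_mem hSm] with ζ hζ
      have hζ0 : 0 < ‖ζ‖ := norm_pos_iff.2 hζ.2
      refine tendsto_const_nhds.congr' ?_
      filter_upwards [Ioo_mem_nhdsGT hζ0] with ε hε
      rw [hXc0 ε hε.1 ζ (by linarith [hε.1, hε.2]), zero_mul, zero_div]
  have hT2 := tendsto_integral_annular_cutoff hz hρ hρ0 hgrad hdX
    (support_dbar_subset_annulus hX1 hX0)
  have hlim : Tendsto (fun ε : ℝ =>
      (∫ ζ in S, (X ζ * dbar w ζ + dbar X ζ * w ζ) / (ζ - z)) -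
      (∫ ζ in S, Xc ε ζ * dbar w ζ / (ζ - z)) -
      ∫ ζ, (ε⁻¹ * dbar X (ε⁻¹ • ζ)) * (ζ - z)⁻¹ * w ζ) (𝓝[>] 0)
      (𝓝 (∫ ζ in S, (X ζ * dbar w ζ + dbar X ζ * w ζ) / (ζ - z))) := by
    simpa using (tendsto_const_nhds.sub hT1).sub hT2
  refine tendsto_nhds_unique (tendsto_const_nhds.congr' ?_) hlim
  filter_upwards [hev] with ε hε
  obtain ⟨hε0, hε⟩ := hε
  have hεz : ε < ‖z‖ := hε.trans_le (min_le_left _ _)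
  have hε2 : ε < 1 / 2 := hε.trans_le (min_le_right _ _)
  let φ : ℂ → ℂ := fun ζ => X ζ - Xc ε ζ
  have hφ : ContDiff ℝ 1 φ := hX'.sub (hXc' ε)
  have hφs : tsupport φ ⊆ closedBall 0 (1 / 2) \ ball 0 (ε / 4) := by
    refine closure_minimal (fun ζ hζ => ?_) (isClosed_closedBall.sdiff isOpen_ball)
    simp only [Set.mem_sdiff, mem_closedBall_zero_iff, mem_ball_zero_iff]
    constructor
    · by_contra! h
      exact hζ (by simp only [φ]; rw [hX0 ζ h.le, hXc0 ε hε0 ζ (by linarith), sub_zero])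
    · intro h
      exact hζ (by simp only [φ]; rw [hX1 ζ (by linarith), hXc1 ε hε0 ζ h.le, sub_self])
  have hφS : tsupport φ ⊆ S := by
    intro ζ hζ
    have := hφs hζ
    simp only [hS, Set.mem_sdiff, mem_closedBall_zero_iff, mem_ball_zero_iff, not_lt,
      Set.mem_singleton_iff] at this ⊢
    exact ⟨by linarith, fun h0 => by rw [h0, norm_zero] at this; linarith⟩
  have hφc : HasCompactSupport φ :=
    ((isCompact_closedBall (0 : ℂ) (1 / 2)).diff isOpen_ball).of_isClosed_subset
      (isClosed_tsupport φ) hφs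
  have hF := hw.contDiff_mul_of_tsupport_subset hSo hφ hφS
  have hdXc : ∀ ζ, dbar (Xc ε) ζ = ε⁻¹ * dbar X (ε⁻¹ • ζ) := fun ζ => by
    simp only [Xc]
    rw [dbar_comp_smul, ofReal_inv]
  have hsc := support_dbar_subset_annulus (hXc1 ε hε0) (hXc0 ε hε0)
  obtain ⟨M, hM⟩ := exists_bound_dbar_mul hw (hXc' ε) (t := ε / 4) (by positivity) ha
    (hsc.trans (Set.sdiff_subset_sdiff_left (closedBall_subset_closedBall (by linarith))))
  have hi3 : IntegrableOn (fun ζ => dbar (Xc ε) ζ * w ζ / (ζ - z)) S :=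
    integrableOn_div_sub hSm hSb (hmeas _ _ ((hXc' ε).dbar (m := 0) (by simp)).continuous
      hw.continuousOn) ha ha1 hM hz1
  have hi4 : IntegrableOn (fun ζ => Xc ε ζ * dbar w ζ / (ζ - z)) S :=
    Integrable.mono hi1 (hmeas' ε) (Eventually.of_forall (hle ε hε0 hε2))
  have hCP := integral_dbar_div_sub hF hφc.mul_right z
  have hφz : φ z = 1 := by
    simp only [φ]
    rw [hX1 z hz4.le, hXc0 ε hε0 z (by linarith), sub_zero]
  simp only [hφz, one_mul] at hCP
  rw [← hCP, ← setIntegral_eq_integral_of_forall_compl_eq_zero (s := S)]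
  · have hT2S : ∫ ζ, (ε⁻¹ * dbar X (ε⁻¹ • ζ)) * (ζ - z)⁻¹ * w ζ =
        ∫ ζ in S, dbar (Xc ε) ζ * w ζ / (ζ - z) := by
      rw [setIntegral_eq_integral_of_forall_compl_eq_zero]
      · congr 1
        ext ζ
        rw [hdXc]
        ring
      · intro ζ hζ
        have : dbar (Xc ε) ζ = 0 := by
          by_contra h
          have := hsc h
          simp only [Set.mem_sdiff, mem_closedBall_zero_iff, mem_ball_zero_iff, not_lt] at this
          refine hζ ⟨by rw [mem_ball_zero_iff]; linarith, fun h0 => ?_⟩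
          rw [Set.mem_singleton_iff.1 h0, norm_zero] at this
          linarith
        rw [this, zero_mul, zero_div]
    rw [hT2S]
    have hi12 : IntegrableOn (fun ζ => (X ζ * dbar w ζ + dbar X ζ * w ζ) / (ζ - z)) S := by
      simp only [add_div]
      exact hi1.add hi2
    have hi124 : IntegrableOn (fun ζ => (X ζ * dbar w ζ + dbar X ζ * w ζ) / (ζ - z) -
        Xc ε ζ * dbar w ζ / (ζ - z)) S := hi12.sub hi4
    rw [← integral_sub hi12 hi4, ← integral_sub hi124 hi3]
    refine setIntegral_congr_fun hSm fun ζ hζ => ?_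
    have hwd : DifferentiableAt ℝ w ζ :=
      (hw.differentiableOn one_ne_zero).differentiableAt (hSo.mem_nhds hζ)
    have h1 := (hφ.differentiable one_ne_zero).differentiableAt (x := ζ)
    have h2 : dbar φ ζ = dbar X ζ - dbar (Xc ε) ζ :=
      dbar_sub (hX'.differentiable one_ne_zero).differentiableAt
        ((hXc' ε).differentiable one_ne_zero).differentiableAt
    simp only [dbar_mul h1 hwd, h2]
    simp only [φ]
    ring
  · intro ζ hζ
    have : dbar (fun ζ => φ ζ * w ζ) ζ = 0 := by
      by_contra h
      exact hζ (hφS (tsupport_mul_subset_left (support_dbar_subset _ h)))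
    rw [this, zero_div]

/-- The gradient of a function which is continuous at a puncture has a limit there, provided its
Laplacian is `O(‖ζ‖ ^ (-a))` with `a < 1`. -/
theorem exists_tendsto_of_dbar_bound {w ρ : ℂ → ℂ} {a C : ℝ}
    (hw : ContDiffOn ℝ 1 w (ball 0 1 \ {0}))
    (hρ : ContDiffOn ℝ 1 ρ (ball 0 1 \ {0})) (hρ0 : Tendsto ρ (𝓝 0) (𝓝 0))
    (hgrad : ∀ ζ ∈ ball (0 : ℂ) 1 \ {0}, w ζ = fderiv ℝ ρ ζ 1 - I * fderiv ℝ ρ ζ I)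
    (ha : 0 < a) (ha1 : a < 1)
    (hb : ∀ ζ ∈ closedBall (0 : ℂ) (1 / 2) \ {0}, ‖dbar w ζ‖ ≤ C * ‖ζ‖ ^ (-a)) :
    ∃ L, Tendsto w (𝓝[≠] 0) (𝓝 L) := by
  obtain ⟨X, hX, hX1, hX0, hXn⟩ := exists_cutoff
  have hdX : ContDiff ℝ 1 (dbar X) := hX.dbar (by norm_num)
  obtain ⟨M, hM⟩ := exists_bound_dbar_mul hw (hX.of_le one_le_two) (by norm_num) ha
    (support_dbar_subset_annulus hX1 hX0)
  have hb1 : ∀ ζ ∈ ball (0 : ℂ) 1 \ {0}, ‖X ζ * dbar w ζ‖ ≤ max |C| M * ‖ζ‖ ^ (-a) := by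
    intro ζ hζ
    by_cases h : 1 / 2 ≤ ‖ζ‖
    · rw [hX0 ζ h, zero_mul, norm_zero]
      positivity
    · push Not at h
      have := hb ζ ⟨by simpa using h.le, hζ.2⟩
      rw [norm_mul]
      calc ‖X ζ‖ * ‖dbar w ζ‖ ≤ 1 * (C * ‖ζ‖ ^ (-a)) := by
            gcongr
            exact hXn ζ
        _ ≤ _ := by
            rw [one_mul]
            gcongr
            exact (le_abs_self C).trans (le_max_left _ _)
  have hb2 : ∀ ζ ∈ ball (0 : ℂ) 1 \ {0}, ‖dbar X ζ * w ζ‖ ≤ max |C| M * ‖ζ‖ ^ (-a) :=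
    fun ζ hζ => (hM ζ hζ).trans (by gcongr; exact le_max_right _ _)
  have hlim := tendsto_setIntegral_div_sub (g := fun ζ => X ζ * dbar w ζ + dbar X ζ * w ζ)
    (C := max |C| M + max |C| M) isOpen_punctured_ball.measurableSet Set.sdiff_subset
    (((hX.continuous.continuousOn.mul (hw.continuousOn_dbar isOpen_punctured_ball)).add
      (hdX.continuous.continuousOn.mul hw.continuousOn)).aestronglyMeasurable
      isOpen_punctured_ball.measurableSet) ha ha1
    fun ζ hζ => by
      rw [add_mul]
      exact (norm_add_le _ _).trans (add_le_add (hb1 ζ hζ) (hb2 ζ hζ))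
  refine ⟨_, (((hlim.mono_left nhdsWithin_le_nhds).const_mul (-(2 * Real.pi) : ℂ)⁻¹)).congr' ?_⟩
  filter_upwards [self_mem_nhdsWithin,
    nhdsWithin_le_nhds (ball_mem_nhds (0 : ℂ) (by norm_num : (0 : ℝ) < 1 / 4))] with z hz hz4
  rw [← eq_setIntegral_of_dbar_bound hw hρ hρ0 hgrad hX hX1 hX0 hXn ha ha1 hb1 hb2 hz
    (by simpa using hz4), inv_mul_cancel_left₀]
  simp [Real.pi_ne_zero]

/-- A function which is differentiable off the origin and whose derivative has a limit at the
origin is differentiable there. -/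
lemma hasFDerivAt_zero_of_tendsto_fderiv {f : ℂ → ℝ} {T : ℂ →L[ℝ] ℝ}
    (hc : ContinuousOn f (ball 0 1)) (hd : DifferentiableOn ℝ f (ball 0 1 \ {0}))
    (hT : Tendsto (fderiv ℝ f) (𝓝[≠] 0) (𝓝 T)) : HasFDerivAt f T 0 := by
  have key : ∀ H : Set ℂ, Convex ℝ H → IsOpen H → 0 ∉ H →
      HasFDerivWithinAt f T (closure (ball 0 (1 / 2) ∩ H)) 0 := by
    intro H hH hHo h0
    have hsub : ball (0 : ℂ) (1 / 2) ∩ H ⊆ ball 0 1 \ {0} := fun ζ hζ =>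
      ⟨ball_subset_ball (by norm_num) hζ.1, fun h => h0 (h ▸ hζ.2)⟩
    refine hasFDerivWithinAt_closure_of_tendsto_fderiv (hd.mono hsub)
      ((convex_ball _ _).inter hH) (isOpen_ball.inter hHo) (fun y hy => ?_)
      (hT.mono_left (nhdsWithin_mono _ fun ζ hζ => (hsub hζ).2))
    refine (hc y ?_).mono (hsub.trans Set.sdiff_subset)
    have := closure_ball_subset_closedBall (closure_mono Set.inter_subset_left hy)
    exact closedBall_subset_ball (by norm_num) this
  have h1 := key {ζ | 0 < ζ.re} (convex_halfSpace_re_gt 0)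
    (isOpen_lt continuous_const continuous_re) (by simp)
  have h2 := key {ζ | ζ.re < 0} (convex_halfSpace_re_lt 0)
    (isOpen_lt continuous_re continuous_const) (by simp)
  refine (h1.union h2).hasFDerivAt (mem_of_superset
    (ball_mem_nhds (0 : ℂ) (by norm_num : (0 : ℝ) < 1 / 2)) ?_)
  have hdense : Dense {ζ : ℂ | ζ.re ≠ 0} :=
    (dense_compl_singleton (0 : ℝ)).preimage isOpenMap_re
  rw [← closure_union, ← Set.inter_union_distrib_left]
  refine (hdense.open_subset_closure_inter isOpen_ball).trans (closure_mono ?_)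
  exact Set.inter_subset_inter_right _ fun ζ hζ => (lt_or_gt_of_ne hζ).symm

lemma hasFDerivAt_log_norm {z : ℂ} (hz : z ≠ 0) :
    HasFDerivAt (fun ζ : ℂ => Real.log ‖ζ‖)
      (reCLM.comp ((ContinuousLinearMap.mul ℝ ℂ) z⁻¹)) z := by
  have hz' : ‖z‖ ^ 2 ≠ 0 := by positivity
  have h := (((hasStrictFDerivAt_norm_sq z).hasFDerivAt.log hz').const_mul (1 / 2 : ℝ))
  have he : (fun ζ : ℂ => 1 / 2 * Real.log (‖ζ‖ ^ 2)) = fun ζ : ℂ => Real.log ‖ζ‖ := by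
    ext ζ
    rw [Real.log_pow]
    push_cast
    ring
  rw [he] at h
  refine h.congr_fderiv ?_
  ext h
  simp [Complex.inv_re, Complex.inv_im, Complex.sq_norm]
  ring

/-- The complex gradient `∂f/∂x - i ∂f/∂y` of a real function. -/
noncomputable def cgrad (f : ℂ → ℝ) (z : ℂ) : ℂ := fderiv ℝ f z 1 - I * fderiv ℝ f z I

lemma fderiv_apply_eq_re_cgrad_mul (f : ℂ → ℝ) (z h : ℂ) :
    fderiv ℝ f z h = (cgrad f z * h).re := by
  have : h = h.re • (1 : ℂ) + h.im • I := by
    simp [Complex.re_add_im]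
  conv_lhs => rw [this, map_add, map_smul, map_smul]
  simp [cgrad]
  ring

lemma cgrad_log_norm {z : ℂ} (hz : z ≠ 0) : cgrad (fun ζ : ℂ => Real.log ‖ζ‖) z = z⁻¹ := by
  rw [cgrad, (hasFDerivAt_log_norm hz).fderiv]
  apply Complex.ext <;> simp

lemma ContDiffOn.cgrad {f : ℂ → ℝ} {S : Set ℂ} (hS : IsOpen S) (hf : ContDiffOn ℝ 2 f S) :
    ContDiffOn ℝ 1 (cgrad f) S := by
  have h := hf.fderiv_of_isOpen hS (m := 1) (by norm_num)
  have h1 : ∀ v : ℂ, ContDiffOn ℝ 1 (fun z => ((fderiv ℝ f z v : ℝ) : ℂ)) S := fun v =>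
    ofRealCLM.contDiff.comp_contDiffOn (h.clm_apply contDiffOn_const)
  exact (h1 1).sub (contDiffOn_const.mul (h1 I))

lemma dbar_cgrad {f : ℂ → ℝ} {z : ℂ} (hf : ContDiffAt ℝ 2 f z) :
    dbar (cgrad f) z = lapl f z := by
  have hd : DifferentiableAt ℝ (fderiv ℝ f) z :=
    (hf.fderiv_right (m := 1) (by norm_num)).differentiableAt one_ne_zero
  have h1 : ∀ v : ℂ, HasFDerivAt (fun z => fderiv ℝ f z v)
      ((fderiv ℝ (fderiv ℝ f) z).flip v) z := fun v => by
    simpa using hd.hasFDerivAt.clm_apply (hasFDerivAt_const v z)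
  have h2 : ∀ v : ℂ, HasFDerivAt (fun z => ((fderiv ℝ f z v : ℝ) : ℂ))
      (ofRealCLM.comp ((fderiv ℝ (fderiv ℝ f) z).flip v)) z := fun v =>
    ofRealCLM.hasFDerivAt.comp z (h1 v)
  have h3 := (h2 1).sub ((h2 I).const_mul I)
  have hsymm := (hf.isSymmSndFDerivAt (by simp)).eq 1 I
  have h4 : fderiv ℝ (cgrad f) z = _ := h3.fderiv
  rw [dbar, h4, lapl, (h1 1).fderiv, (h1 I).fderiv]
  simp [hsymm]
  linear_combination (-(fderiv ℝ (fderiv ℝ f) z I I : ℂ)) * I_mul_I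

lemma dbar_inv {z : ℂ} (hz : z ≠ 0) (c : ℂ) : dbar (fun ζ => c * ζ⁻¹) z = 0 := by
  have h : HasDerivAt (fun ζ : ℂ => c * ζ⁻¹) (c * -(z ^ 2)⁻¹) z := (hasDerivAt_inv hz).const_mul c
  rw [dbar, (h.hasFDerivAt.restrictScalars ℝ).fderiv]
  simp
  linear_combination (-c * (z ^ 2)⁻¹) * I_mul_I

/-- A continuous function `r` such that `u z = γ * log ‖z‖ + r z` solves `Δu = k e^{2u}` in the
punctured disc, with `k` bounded and `γ > -1/2`, is of class `C¹` in the whole disc. -/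
theorem contDiffOn_remainder {k u : ℂ → ℝ} {γ : ℝ} {r : ℂ → ℝ}
    (hk_bdd : ∃ M : ℝ, ∀ z ∈ ball (0 : ℂ) 1 \ {0}, |k z| ≤ M)
    (hu : ContDiffOn ℝ 2 u (ball (0 : ℂ) 1 \ {0}))
    (hpde : ∀ z ∈ ball (0 : ℂ) 1 \ {0}, lapl u z = k z * Real.exp (2 * u z))
    (hr_cont : ContinuousOn r (ball (0 : ℂ) 1))
    (hdecomp : ∀ z ∈ ball (0 : ℂ) 1 \ {0}, u z = γ * Real.log ‖z‖ + r z)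
    (hγ : -(1 / 2 : ℝ) < γ) :
    ContDiffOn ℝ 1 r (ball (0 : ℂ) 1) := by
  have hSo : IsOpen (ball (0 : ℂ) 1 \ {0}) := isOpen_punctured_ball
  have h0 : (0 : ℂ) ∈ ball (0 : ℂ) 1 := by simp
  have hr2 : ContDiffOn ℝ 2 r (ball 0 1 \ {0}) := by
    have hlog : ContDiffOn ℝ 2 (fun z : ℂ => γ * Real.log ‖z‖) (ball 0 1 \ {0}) :=
      fun z hz => (contDiffAt_const.mul
        ((contDiffAt_norm ℝ hz.2).log (norm_ne_zero_iff.2 hz.2))).contDiffWithinAt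
    exact (hu.sub hlog).congr fun z hz => by rw [hdecomp z hz]; ring
  have hdiff : ∀ {f : ℂ → ℝ}, ContDiffOn ℝ 2 f (ball 0 1 \ {0}) →
      ∀ z ∈ ball (0 : ℂ) 1 \ {0}, DifferentiableAt ℝ f z := fun hf z hz =>
    (hf.differentiableOn two_ne_zero).differentiableAt (hSo.mem_nhds hz)
  have hcg : ∀ z ∈ ball (0 : ℂ) 1 \ {0}, cgrad r z = cgrad u z - γ * z⁻¹ := by
    intro z hz
    have hev : u =ᶠ[𝓝 z] fun z => γ * Real.log ‖z‖ + r z := by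
      filter_upwards [hSo.mem_nhds hz] with ζ hζ using hdecomp ζ hζ
    have := hev.fderiv_eq.trans (((hasFDerivAt_log_norm hz.2).const_mul γ).add
      (hdiff hr2 z hz).hasFDerivAt).fderiv
    have hlog := (hasFDerivAt_log_norm hz.2).fderiv
    rw [← cgrad_log_norm hz.2, cgrad, cgrad, cgrad, this, hlog]
    simp only [add_apply, smul_apply, smul_eq_mul]
    push_cast
    ring
  have hdbar : ∀ z ∈ ball (0 : ℂ) 1 \ {0}, dbar (cgrad r) z = k z * Real.exp (2 * u z) := by
    intro z hz
    have hev : cgrad r =ᶠ[𝓝 z] fun z => cgrad u z - γ * z⁻¹ := by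
      filter_upwards [hSo.mem_nhds hz] with ζ hζ using hcg ζ hζ
    have h1 : DifferentiableAt ℝ (cgrad u) z :=
      ((hu.cgrad hSo).differentiableOn one_ne_zero).differentiableAt (hSo.mem_nhds hz)
    have h2 : DifferentiableAt ℝ (fun z : ℂ => (γ : ℂ) * z⁻¹) z :=
      DifferentiableAt.const_mul (differentiableAt_inv hz.2) _
    calc dbar (cgrad r) z = dbar (fun z => cgrad u z - γ * z⁻¹) z := by
          rw [dbar, dbar, hev.fderiv_eq]
      _ = dbar (cgrad u) z - dbar (fun z => γ * z⁻¹) z := dbar_sub h1 h2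
      _ = _ := by
          rw [dbar_inv hz.2, dbar_cgrad (hu.contDiffAt (hSo.mem_nhds hz)), hpde z hz]
          push_cast
          ring
  obtain ⟨M, hM⟩ := hk_bdd
  obtain ⟨B, hB⟩ := (isCompact_closedBall (0 : ℂ) (1 / 2)).exists_bound_of_continuousOn
    (hr_cont.mono (closedBall_subset_ball (by norm_num)))
  obtain ⟨L, hL⟩ : ∃ L, Tendsto (cgrad r) (𝓝[≠] 0) (𝓝 L) := by
    refine exists_tendsto_of_dbar_bound (ρ := fun z => ((r z - r 0 : ℝ) : ℂ))
      (a := max (-(2 * γ)) (1 / 2)) (C := |M| * Real.exp (2 * B)) (hr2.cgrad hSo)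
      (ofRealCLM.contDiff.comp_contDiffOn ((hr2.of_le one_le_two).sub contDiffOn_const)) ?_ ?_
      (by positivity) (max_lt (by linarith) (by norm_num)) ?_
    · have h : ContinuousAt r 0 := hr_cont.continuousAt (isOpen_ball.mem_nhds h0)
      have := (continuous_ofReal.tendsto _).comp (h.tendsto.sub_const (r 0))
      simpa [Function.comp_def] using this
    · intro z hz
      have := (ofRealCLM.hasFDerivAt.comp z ((hdiff hr2 z hz).hasFDerivAt.sub_const (r 0))).fderiv
      have h' : fderiv ℝ (fun z => ((r z - r 0 : ℝ) : ℂ)) z = _ := this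
      rw [h', cgrad]
      simp
    · intro z hz
      have hz1 : z ∈ ball (0 : ℂ) 1 \ {0} := ⟨closedBall_subset_ball (by norm_num) hz.1, hz.2⟩
      have hzn : 0 < ‖z‖ := norm_pos_iff.2 hz.2
      have hexp : Real.exp (2 * u z) ≤ ‖z‖ ^ (-(max (-(2 * γ)) (1 / 2))) * Real.exp (2 * B) := by
        have h1 : Real.exp (2 * u z) = ‖z‖ ^ (2 * γ) * Real.exp (2 * r z) := by
          rw [Real.rpow_def_of_pos hzn, ← Real.exp_add, hdecomp z hz1]
          ring_nf
        rw [h1]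
        gcongr ?_ * Real.exp (2 * ?_)
        · exact Real.rpow_le_rpow_of_exponent_ge hzn (mem_ball_zero_iff.1 hz1.1).le
            (by linarith [le_max_left (-(2 * γ)) (1 / 2)])
        · exact (le_abs_self _).trans (hB z hz.1)
      rw [hdbar z hz1, norm_mul, norm_real, norm_real, Real.norm_eq_abs, Real.norm_eq_abs,
        Real.abs_exp]
      calc |k z| * Real.exp (2 * u z) ≤ |M| * _ :=
            mul_le_mul ((hM z hz1).trans (le_abs_self M)) hexp (by positivity) (by positivity)
        _ = _ := by ring
  have hfd : ∀ z, fderiv ℝ r z = reCLM.comp (ContinuousLinearMap.mul ℝ ℂ (cgrad r z)) := fun z => by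
    refine ContinuousLinearMap.ext fun h => ?_
    simpa using fderiv_apply_eq_re_cgrad_mul r z h
  have hlim : Tendsto (fderiv ℝ r) (𝓝[≠] 0) (𝓝 (reCLM.comp (ContinuousLinearMap.mul ℝ ℂ L))) := by
    rw [funext hfd]
    exact (((by fun_prop : Continuous fun c => reCLM.comp (ContinuousLinearMap.mul ℝ ℂ c))).tendsto
      L).comp hL
  have hat := hasFDerivAt_zero_of_tendsto_fderiv hr_cont (hr2.differentiableOn two_ne_zero) hlim
  have hmain : ContDiffOn ℝ (0 + 1) r (ball 0 1) := by
    rw [contDiffOn_succ_iff_fderiv_of_isOpen isOpen_ball]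
    refine ⟨fun z hz => ?_, by simp, contDiffOn_zero.2 fun z hz => ?_⟩
    · by_cases hz0 : z = 0
      · subst hz0
        exact hat.differentiableAt.differentiableWithinAt
      · exact (hdiff hr2 z ⟨hz, hz0⟩).differentiableWithinAt
    · refine ContinuousAt.continuousWithinAt ?_
      by_cases hz0 : z = 0
      · subst hz0
        rw [continuousAt_iff_punctured_nhds, hat.fderiv]
        exact hlim
      · exact (hr2.continuousOn_fderiv_of_isOpen hSo one_le_two).continuousAt
          (hSo.mem_nhds ⟨hz, hz0⟩)
  simpa using hmain

end

/-- Theorem 1.1 (C¹ regularity of the remainder): with u = γ·log|z| + r as in the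
expansion, if γ > −1/2 then r is C¹ on all of 𝔻. -/
theorem remainder_C1 (k u : ℂ → ℝ) (γ : ℝ) (r : ℂ → ℝ)
    (hk_cont : ContinuousOn k (ball (0 : ℂ) 1 \ {0}))
    (hk_bdd : ∃ M : ℝ, ∀ z ∈ ball (0 : ℂ) 1 \ {0}, |k z| ≤ M)
    (hk_nonpos : ∀ z ∈ ball (0 : ℂ) 1 \ {0}, k z ≤ 0)
    (hu : ContDiffOn ℝ 2 u (ball (0 : ℂ) 1 \ {0}))
    (hpde : ∀ z ∈ ball (0 : ℂ) 1 \ {0}, lapl u z = k z * Real.exp (2 * u z))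
    (hint : ∫⁻ z in ball (0 : ℂ) 1, ENNReal.ofReal (Real.exp (2 * u z)) < ⊤)
    (hγ : -1 < γ)
    (hr_cont : ContinuousOn r (ball (0 : ℂ) 1))
    (hdecomp : ∀ z ∈ ball (0 : ℂ) 1 \ {0}, u z = γ * Real.log ‖z‖ + r z)
    (hγ2 : -(1/2 : ℝ) < γ) :
    ContDiffOn ℝ 1 r (ball (0 : ℂ) 1) := by
  
  exact contDiffOn_remainder hk_bdd hu hpde hr_cont hdecomp hγ2
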